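/- arXiv:1107.0228 — 2 statements merged into one kernel-verified Lean document; each statement's English description precedes it below -/
import Mathlib

section
/- The limit σ² := lim_{N→∞} (1/ln N) ∫_{𝕋²} π(dk) ∫_0^∞ e^{-z} z² ψ¹(k)² 𝟙{z|ψ¹(k)| ≤ √N} dz exists and equals 1/(128π) (i.e. (1/64)·(1/(2π))). -/
open MeasureTheory Real Filter Set
open scoped ENNReal NNReal

noncomputable section

instance : Fact ((0:ℝ) < 1) := ⟨one_pos⟩

/-- The one-dimensional torus `ℝ/ℤ`. -/
abbrev Torus := AddCircle (1 : ℝ)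

/-- The two-dimensional torus `𝕋²`. -/
abbrev T2 := Torus × Torus

lemma sin_sq_periodic : Function.Periodic (fun x : ℝ => Real.sin (π * x) ^ 2) 1 := by
  intro x
  simp only []
  have h : π * (x + 1) = π * x + π := by ring
  rw [h, Real.sin_add_pi]
  ring

lemma sincos_periodic :
    Function.Periodic (fun x : ℝ => Real.sin (π * x) * Real.cos (π * x)) 1 := by
  intro x
  simp only []
  have h : π * (x + 1) = π * x + π := by ring
  rw [h, Real.sin_add_pi, Real.cos_add_pi]
  ring

/-- `sin²(π k)` as a function on the circle. -/
def sin2 : Torus → ℝ := sin_sq_periodic.lift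

/-- `sin(π k) cos(π k)` as a function on the circle. -/
def sincos : Torus → ℝ := sincos_periodic.lift

/-- The components of a point of the torus. -/
def tcomp (k : T2) : Fin 2 → Torus := ![k.1, k.2]

/-- `Φ(k) = 8 ∑_α sin²(π k_α)`. -/
def Phi (k : T2) : ℝ := 8 * (sin2 k.1 + sin2 k.2)

/-- The scattering kernel `R(k,k') = 16 ∑_α sin²(π k_α) sin²(π k'_α)`. -/
def Rker (k k' : T2) : ℝ := 16 * (sin2 k.1 * sin2 k'.1 + sin2 k.2 * sin2 k'.2)

/-- The velocity `v_α(k) = sin(π k_α) cos(π k_α) / (∑_β sin²(π k_β))^{1/2}`. -/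
def vel (α : Fin 2) (k : T2) : ℝ :=
  sincos (tcomp k α) / Real.sqrt (sin2 k.1 + sin2 k.2)

/-- `ψ(k) = Φ(k)⁻¹ v(k)`. -/
def psiC (α : Fin 2) (k : T2) : ℝ := vel α k / Phi k

/-- The Markov transition kernel `P(k,dk') = Φ(k)⁻¹ R(k,k') dk'` on `𝕋²`. -/
def Pker (k : T2) : Measure T2 :=
  (volume : Measure T2).withDensity fun k' => ENNReal.ofReal ((Phi k)⁻¹ * Rker k k')

/-- The `m`-step kernel (`Pn 0 k` is the Dirac mass at `k`). -/
def Pn : ℕ → T2 → Measure T2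
  | 0, k => Measure.dirac k
  | (m + 1), k => (Pn m k).bind Pker

/-- The measure `π(dk) = (1/8) Φ(k) dk`. -/
def piM : Measure T2 :=
  (volume : Measure T2).withDensity fun k => ENNReal.ofReal ((1 / 8) * Phi k)

/-- The exponential distribution with mean one. -/
def expMeasure : Measure ℝ :=
  (volume : Measure ℝ).withDensity fun z =>
    if 0 ≤ z then ENNReal.ofReal (Real.exp (-z)) else 0


/-- The truncated second moment. -/
def HH (t p : ℝ) : ℝ := ∫ z in Set.Ioi (0:ℝ),
        Real.exp (-z) * (z * p) ^ 2 * (if z * |p| ≤ t then 1 else 0)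

lemma gam_integrable (n : ℕ) : IntegrableOn (fun z : ℝ => Real.exp (-z) * z ^ n) (Ioi 0) := by
  have h := Real.GammaIntegral_convergent (s := n + 1) (by positivity)
  simpa using h

lemma gam_integral (n : ℕ) : ∫ z in Ioi (0:ℝ), Real.exp (-z) * z ^ n = n.factorial := by
  have h := Real.Gamma_eq_integral (s := n + 1) (by positivity)
  rw [Real.Gamma_nat_eq_factorial] at h
  rw [h]; simp

lemma HH_meas_aux (t : ℝ) : Measurable (fun q : ℝ × ℝ =>
    Real.exp (-q.2) * (q.2 * q.1) ^ 2 * (if q.2 * |q.1| ≤ t then (1:ℝ) else 0)) := by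
  refine Measurable.mul (by fun_prop) (Measurable.ite ?_ measurable_const measurable_const)
  exact measurableSet_le (by fun_prop) (by fun_prop)

lemma HH_meas (t : ℝ) : Measurable (HH t) := by
  have := StronglyMeasurable.integral_prod_right (ν := volume.restrict (Ioi (0:ℝ)))
    (f := fun p z : ℝ => Real.exp (-z) * (z * p) ^ 2 * (if z * |p| ≤ t then (1:ℝ) else 0))
    (HH_meas_aux t).stronglyMeasurable
  exact this.measurable

lemma HH_integrable (t p : ℝ) : IntegrableOn (fun z : ℝ =>
    Real.exp (-z) * (z * p) ^ 2 * (if z * |p| ≤ t then 1 else 0)) (Ioi 0) := by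
  refine Integrable.mono' ((gam_integrable 2).mul_const (p ^ 2)) ?_ ?_
  · exact ((HH_meas_aux t).comp (measurable_const.prodMk measurable_id)).aestronglyMeasurable
  · refine Eventually.of_forall fun z => ?_
    rw [Real.norm_eq_abs, abs_of_nonneg (by split_ifs <;> positivity)]
    have : 0 ≤ Real.exp (-z) * (z * p) ^ 2 := by positivity
    split_ifs
    · exact le_of_eq (by ring)
    · rw [mul_zero]; positivity

lemma HH_nonneg (t p : ℝ) : 0 ≤ HH t p :=
  integral_nonneg fun z => by
    simp only [Pi.zero_apply]
    split_ifs <;> positivity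

lemma HH_le_sq (t p : ℝ) (ht : 0 ≤ t) : HH t p ≤ t ^ 2 := by
  have h0 : ∫ z in Ioi (0:ℝ), Real.exp (-z) * z ^ 0 * t ^ 2 = t ^ 2 := by
    rw [integral_mul_const, gam_integral]; simp
  rw [← h0]
  refine setIntegral_mono_on (HH_integrable t p) ((gam_integrable 0).mul_const _)
    measurableSet_Ioi fun z hz => ?_
  have hz : 0 < z := hz
  split_ifs with h
  · have : (z * p) ^ 2 ≤ t ^ 2 := by
      rw [← sq_abs (z * p), abs_mul, abs_of_pos hz]
      gcongr
    have he := Real.exp_pos (-z)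
    simp only [pow_zero, mul_one]
    gcongr
  · rw [mul_zero]; positivity

lemma HH_le (t p : ℝ) : HH t p ≤ 2 * p ^ 2 := by
  have h0 : ∫ z in Ioi (0:ℝ), Real.exp (-z) * z ^ 2 * p ^ 2 = 2 * p ^ 2 := by
    rw [integral_mul_const, gam_integral]; simp
  rw [← h0]
  refine setIntegral_mono_on (HH_integrable t p) ((gam_integrable 2).mul_const _)
    measurableSet_Ioi fun z hz => ?_
  split_ifs with h
  · exact le_of_eq (by ring)
  · rw [mul_zero]; positivity

lemma HH_ge (t p : ℝ) (ht : 0 < t) : 2 * p ^ 2 - 6 * |p| ^ 3 / t ≤ HH t p := by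
  have h0 : ∫ z in Ioi (0:ℝ), (Real.exp (-z) * z ^ 2 * p ^ 2 - Real.exp (-z) * z ^ 3 * (|p| ^ 3 / t))
      = 2 * p ^ 2 - 6 * |p| ^ 3 / t := by
    rw [integral_sub ((gam_integrable 2).mul_const _) ((gam_integrable 3).mul_const _),
      integral_mul_const, gam_integral, integral_mul_const, gam_integral]
    simp [Nat.factorial]; ring
  rw [← h0]
  refine setIntegral_mono_on (((gam_integrable 2).mul_const _).sub ((gam_integrable 3).mul_const _))
    (HH_integrable t p) measurableSet_Ioi fun z hz => ?_
  have hz : 0 < z := hz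
  split_ifs with h
  · have : 0 ≤ Real.exp (-z) * z ^ 3 * (|p| ^ 3 / t) := by positivity
    linarith [mul_pow z p 2]
  · push Not at h
    have h1 : 1 ≤ z * |p| / t := by rw [le_div_iff₀ ht]; linarith
    have h2 : Real.exp (-z) * z ^ 3 * (|p| ^ 3 / t) = Real.exp (-z) * z ^ 2 * p ^ 2 * (z * |p| / t) := by
      rw [← sq_abs p]; ring
    have h3 : 0 ≤ Real.exp (-z) * z ^ 2 * p ^ 2 := by positivity
    rw [h2, mul_zero]
    nlinarith

/-- radial integration -/
lemma radial_integral (φ : ℝ → ℝ) :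
    ∫ p : ℝ × ℝ, φ (√(p.1 ^ 2 + p.2 ^ 2)) = 2 * π * ∫ r in Ioi (0:ℝ), r * φ r := by
  rw [← integral_comp_polarCoord_symm]
  have h : ∫ p in polarCoord.target, p.1 • φ (√((polarCoord.symm p).1 ^ 2 + (polarCoord.symm p).2 ^ 2))
      = ∫ p in (Ioi (0:ℝ)) ×ˢ (Ioo (-π) π), (p.1 * φ p.1) * (1:ℝ) := by
    refine setIntegral_congr_fun (by exact measurableSet_Ioi.prod measurableSet_Ioo) fun p hp => ?_
    have hp1 : 0 < p.1 := hp.1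
    have : (polarCoord.symm p).1 ^ 2 + (polarCoord.symm p).2 ^ 2 = p.1 ^ 2 := by
      simp only [polarCoord_symm_apply]
      nlinarith [Real.sin_sq_add_cos_sq p.2]
    simp only [this, Real.sqrt_sq hp1.le, smul_eq_mul, mul_one]
  rw [h, Measure.volume_eq_prod, setIntegral_prod_mul (fun r => r * φ r) (fun _ => (1:ℝ))]
  simp [Real.pi_pos.le]
  ring

lemma radial_integrable (φ : ℝ → ℝ) (hφ : Measurable φ) (C : ℝ) (hC : ∀ r, 0 ≤ r → |φ r| ≤ C)
    (h1 : ∀ r, 1 ≤ r → φ r = 0) :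
    Integrable (fun p : ℝ × ℝ => φ (√(p.1 ^ 2 + p.2 ^ 2))) := by
  have hm : Measurable (fun p : ℝ × ℝ => φ (√(p.1 ^ 2 + p.2 ^ 2))) :=
    hφ.comp (by fun_prop)
  have : IntegrableOn (fun p : ℝ × ℝ => φ (√(p.1 ^ 2 + p.2 ^ 2))) (Icc (-1) 1 ×ˢ Icc (-1) 1) := by
    refine Measure.integrableOn_of_bounded (M := C) ?_ hm.aestronglyMeasurable
      (Eventually.of_forall fun p => hC _ (Real.sqrt_nonneg _))
    exact (isCompact_Icc.prod isCompact_Icc).measure_lt_top.ne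
  refine this.integrable_of_forall_notMem_eq_zero fun p hp => h1 _ ?_
  by_contra hlt
  push Not at hlt
  rw [Real.sqrt_lt' one_pos] at hlt
  apply hp
  refine ⟨abs_le.mp (abs_le_of_sq_le_sq (by nlinarith [sq_nonneg p.2]) zero_le_one),
    abs_le.mp (abs_le_of_sq_le_sq (by nlinarith [sq_nonneg p.1]) zero_le_one)⟩

lemma sin_lower (x : ℝ) (hx : |x| ≤ 1 / 2) : 4 * x ^ 2 ≤ Real.sin (π * x) ^ 2 := by
  have hp := Real.pi_pos
  have h := Real.mul_le_sin (x := π * |x|) (by positivity) (by nlinarith)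
  have e : Real.sin (π * x) ^ 2 = Real.sin (π * |x|) ^ 2 := by
    rcases abs_choice x with h | h <;> rw [h]
    rw [mul_neg, Real.sin_neg, neg_sq]
  rw [e]
  have h' : 2 * |x| ≤ Real.sin (π * |x|) := by
    refine le_trans (le_of_eq ?_) h; field_simp
  calc 4 * x ^ 2 = (2 * |x|) ^ 2 := by rw [mul_pow, sq_abs]; ring
    _ ≤ _ := by gcongr

lemma sin_upper (x : ℝ) : Real.sin (π * x) ^ 2 ≤ π ^ 2 * x ^ 2 := by
  rw [← mul_pow]
  exact sq_le_sq.mpr Real.abs_sin_le_abs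

lemma sin_tan (x : ℝ) (hx : |x| ≤ 1 / 2) :
    π ^ 2 * x ^ 2 - Real.sin (π * x) ^ 2 ≤ π ^ 2 * x ^ 2 * Real.sin (π * x) ^ 2 := by
  have hp := Real.pi_pos
  have e : Real.sin (π * x) ^ 2 = Real.sin (π * |x|) ^ 2 := by
    rcases abs_choice x with h | h <;> rw [h]
    rw [mul_neg, Real.sin_neg, neg_sq]
  rw [e, ← sq_abs x]
  rcases hx.lt_or_eq with h | h
  · have hc : 0 < Real.cos (π * |x|) :=
      Real.cos_pos_of_mem_Ioo ⟨by nlinarith [abs_nonneg x], by nlinarith⟩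
    have ht := Real.le_tan (x := π * |x|) (by positivity) (by nlinarith)
    rw [Real.tan_eq_sin_div_cos, le_div_iff₀ hc] at ht
    have h2 : (π * |x| * Real.cos (π * |x|)) ^ 2 ≤ Real.sin (π * |x|) ^ 2 := by gcongr
    have h3 := Real.cos_sq' (π * |x|)
    rw [mul_pow, h3] at h2
    linarith
  · rw [h, mul_one_div, Real.sin_pi_div_two]; linarith

def SS (x y : ℝ) : ℝ := Real.sin (π * x) ^ 2 + Real.sin (π * y) ^ 2

def PP (x y : ℝ) : ℝ :=
  Real.sin (π * x) * Real.cos (π * x) / Real.sqrt (SS x y) / (8 * SS x y)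

def gg (t x y : ℝ) : ℝ := SS x y * HH t (PP x y)

lemma SS_nonneg (x y : ℝ) : 0 ≤ SS x y := by unfold SS; positivity

lemma SS_comm (x y : ℝ) : SS x y = SS y x := by unfold SS; ring

lemma SS_le_two (x y : ℝ) : SS x y ≤ 2 := by
  unfold SS; linarith [Real.sin_sq_le_one (π * x), Real.sin_sq_le_one (π * y)]

lemma gg_nonneg (t x y : ℝ) : 0 ≤ gg t x y := mul_nonneg (SS_nonneg x y) (HH_nonneg _ _)

lemma gg_le (t x y : ℝ) (ht : 0 ≤ t) : gg t x y ≤ SS x y * t ^ 2 :=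
  mul_le_mul_of_nonneg_left (HH_le_sq _ _ ht) (SS_nonneg x y)

lemma gg_meas (t : ℝ) : Measurable (fun p : ℝ × ℝ => gg t p.1 p.2) := by
  unfold gg
  refine Measurable.mul (by unfold SS; fun_prop) ((HH_meas t).comp ?_)
  unfold PP SS; fun_prop

lemma PP_sq (x y : ℝ) (hS : 0 < SS x y) :
    PP x y ^ 2 = Real.sin (π * x) ^ 2 * Real.cos (π * x) ^ 2 / (64 * SS x y ^ 3) := by
  unfold PP
  rw [div_pow, div_pow, Real.sq_sqrt hS.le]
  field_simp
  ring

lemma PP_abs (x y : ℝ) (hS : 0 < SS x y) : |PP x y| ≤ 1 / (8 * SS x y) := by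
  refine abs_le_of_sq_le_sq ?_ (by positivity)
  rw [PP_sq x y hS, div_pow, div_le_div_iff₀ (by positivity) (by positivity)]
  have h1 : Real.sin (π * x) ^ 2 * Real.cos (π * x) ^ 2 ≤ SS x y := by
    have h2 := Real.cos_sq_le_one (π * x)
    unfold SS; nlinarith [sq_nonneg (Real.sin (π * x)), sq_nonneg (Real.sin (π * y))]
  calc _ ≤ SS x y * (8 * SS x y) ^ 2 := by gcongr
    _ = _ := by ring

lemma gg_approx (t x y : ℝ) (ht : 0 < t) (hS : 0 < SS x y) :
    |gg t x y - Real.sin (π * x) ^ 2 * Real.cos (π * x) ^ 2 / (32 * SS x y ^ 2)|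
      ≤ 1 / (t * SS x y ^ 2) := by
  have h1 := HH_le t (PP x y)
  have h2 := HH_ge t (PP x y) ht
  have h3 : Real.sin (π * x) ^ 2 * Real.cos (π * x) ^ 2 / (32 * SS x y ^ 2)
      = SS x y * (2 * PP x y ^ 2) := by
    rw [PP_sq x y hS]; field_simp; ring
  have h4 : SS x y * (6 * |PP x y| ^ 3 / t) ≤ 1 / (t * SS x y ^ 2) := by
    calc SS x y * (6 * |PP x y| ^ 3 / t) ≤ SS x y * (6 * (1 / (8 * SS x y)) ^ 3 / t) := by
          gcongr; exact PP_abs x y hS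
      _ = (6 / 512) * (1 / (t * SS x y ^ 2)) := by field_simp; norm_num
      _ ≤ _ := by
          have : 0 ≤ 1 / (t * SS x y ^ 2) := by positivity
          linarith
  rw [h3, abs_le]; unfold gg
  constructor
  · nlinarith
  · have : 0 ≤ 1 / (t * SS x y ^ 2) := by positivity
    nlinarith

def phiM (ρ r : ℝ) : ℝ := if ρ ≤ r ∧ r < 1 / 2 then 1 / (32 * π ^ 2 * r ^ 2) else 0

def phiE (ρ t r : ℝ) : ℝ :=
  (if r < ρ then 20 * t else 0) + (if ρ ≤ r ∧ r < 1 then 2 / (t * r ^ 4) else 0)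

lemma inv_diff (x y : ℝ) (hx : |x| ≤ 1 / 2) (hy : |y| ≤ 1 / 2) (hr : 0 < x ^ 2 + y ^ 2) :
    0 < SS x y ∧ 0 ≤ 1 / SS x y - 1 / (π ^ 2 * (x ^ 2 + y ^ 2)) ∧
      1 / SS x y - 1 / (π ^ 2 * (x ^ 2 + y ^ 2)) ≤ 1 ∧ 4 * (x ^ 2 + y ^ 2) ≤ SS x y := by
  have hp := Real.pi_pos
  have a1 := sin_lower x hx
  have a2 := sin_lower y hy
  have b1 := sin_upper x
  have b2 := sin_upper y
  have c1 := sin_tan x hx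
  have c2 := sin_tan y hy
  have hS4 : 4 * (x ^ 2 + y ^ 2) ≤ SS x y := by unfold SS; linarith
  have hS : 0 < SS x y := by linarith
  have hR : 0 < π ^ 2 * (x ^ 2 + y ^ 2) := by positivity
  refine ⟨hS, ?_, ?_, hS4⟩
  · rw [sub_nonneg]
    refine one_div_le_one_div_of_le hS ?_
    unfold SS; linarith
  · rw [div_sub_div _ _ hS.ne' hR.ne', div_le_one (by positivity)]
    have : π ^ 2 * x ^ 2 * Real.sin (π * x) ^ 2 + π ^ 2 * y ^ 2 * Real.sin (π * y) ^ 2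
        ≤ SS x y * (π ^ 2 * (x ^ 2 + y ^ 2)) := by
      unfold SS
      have u1 : 0 ≤ π ^ 2 * x ^ 2 * Real.sin (π * y) ^ 2 := by positivity
      have u2 : 0 ≤ π ^ 2 * y ^ 2 * Real.sin (π * x) ^ 2 := by positivity
      linarith
    have e : SS x y = Real.sin (π * x) ^ 2 + Real.sin (π * y) ^ 2 := rfl
    linarith

lemma pointwise (t ρ x y : ℝ) (ht : 0 < t) (hρ : 0 < ρ) (hρt : t * ρ ^ 2 = 1)
    (hx : |x| ≤ 1 / 2) (hy : |y| ≤ 1 / 2) :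
    |gg t x y + gg t y x - phiM ρ (√(x ^ 2 + y ^ 2))| ≤ 1 + phiE ρ t (√(x ^ 2 + y ^ 2)) := by
  set r := √(x ^ 2 + y ^ 2) with hr
  have hr0 : 0 ≤ r := Real.sqrt_nonneg _
  have hr2 : r ^ 2 = x ^ 2 + y ^ 2 := Real.sq_sqrt (by positivity)
  have hp := Real.pi_pos
  have hp3 := Real.pi_gt_three
  have hp4 : π ^ 2 < 10 := by nlinarith [Real.pi_lt_d2]
  by_cases hlt : r < ρ
  · have hM : phiM ρ r = 0 := if_neg (by rintro ⟨h, _⟩; linarith)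
    have hE : phiE ρ t r = 20 * t := by
      unfold phiE; rw [if_pos hlt, if_neg (by rintro ⟨h, _⟩; linarith), add_zero]
    have hS : SS x y ≤ 10 * ρ ^ 2 := by
      have : SS x y ≤ π ^ 2 * r ^ 2 := by
        rw [hr2]; unfold SS; linarith [sin_upper x, sin_upper y]
      calc SS x y ≤ π ^ 2 * r ^ 2 := this
        _ ≤ 10 * ρ ^ 2 := by gcongr
    have hSt : SS x y * t ^ 2 ≤ 10 * t := by
      calc SS x y * t ^ 2 ≤ 10 * ρ ^ 2 * t ^ 2 := by gcongr
        _ = 10 * t * (t * ρ ^ 2) := by ring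
        _ = 10 * t := by rw [hρt, mul_one]
    have h1 := gg_le t x y ht.le
    have h2 := gg_le t y x ht.le
    rw [← SS_comm x y] at h2
    rw [hM, hE, sub_zero, abs_of_nonneg (add_nonneg (gg_nonneg _ _ _) (gg_nonneg _ _ _))]
    linarith
  · push Not at hlt
    have hrp : 0 < r := by linarith
    have hr2p : 0 < x ^ 2 + y ^ 2 := by rw [← hr2]; positivity
    obtain ⟨hS, d0, d1, hS4⟩ := inv_diff x y hx hy hr2p
    rw [← hr2] at d0 d1 hS4
    have g1 := gg_approx t x y ht hS
    have g2 := gg_approx t y x ht (by rwa [SS_comm])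
    rw [← SS_comm x y] at g2
    have hr1 : r < 1 := by
      have : r ^ 2 ≤ 1 / 2 := by
        rw [hr2, ← sq_abs x, ← sq_abs y]; nlinarith [abs_nonneg x, abs_nonneg y]
      nlinarith
    have hE : phiE ρ t r = 2 / (t * r ^ 4) := by
      unfold phiE; rw [if_neg (by linarith), if_pos ⟨hlt, hr1⟩, zero_add]
    have hS2 : 1 / (t * SS x y ^ 2) ≤ 1 / (t * r ^ 4) := by
      refine one_div_le_one_div_of_le (by positivity) ?_
      have : r ^ 4 ≤ SS x y ^ 2 := by
        calc r ^ 4 = (r ^ 2) ^ 2 := by ring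
          _ ≤ _ := by gcongr; nlinarith
      gcongr
    have hsum : Real.sin (π * x) ^ 2 * Real.cos (π * x) ^ 2 / (32 * SS x y ^ 2)
        + Real.sin (π * y) ^ 2 * Real.cos (π * y) ^ 2 / (32 * SS x y ^ 2)
        = (1 / 32) * (1 / SS x y)
          - (1 / 32) * ((Real.sin (π * x) ^ 4 + Real.sin (π * y) ^ 4) / SS x y ^ 2) := by
      rw [Real.cos_sq', Real.cos_sq']
      have e : SS x y = Real.sin (π * x) ^ 2 + Real.sin (π * y) ^ 2 := rfl
      field_simp
      rw [e]; ring
    have hq0 : 0 ≤ (Real.sin (π * x) ^ 4 + Real.sin (π * y) ^ 4) / SS x y ^ 2 := by positivity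
    have hq1 : (Real.sin (π * x) ^ 4 + Real.sin (π * y) ^ 4) / SS x y ^ 2 ≤ 1 := by
      rw [div_le_one (by positivity)]
      unfold SS
      nlinarith [mul_nonneg (sq_nonneg (Real.sin (π * x))) (sq_nonneg (Real.sin (π * y)))]
    have hM : |phiM ρ r - (1 / 32) * (1 / (π ^ 2 * r ^ 2))| ≤ 1 / 32 := by
      unfold phiM
      split_ifs with h
      · rw [show 1 / (32 * π ^ 2 * r ^ 2) - (1 / 32) * (1 / (π ^ 2 * r ^ 2)) = 0 by
          field_simp; ring]
        norm_num
      · have hh : 1 / 2 ≤ r := by by_contra hc; exact h ⟨hlt, by linarith⟩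
        have : 1 / (π ^ 2 * r ^ 2) ≤ 1 := by
          rw [div_le_one (by positivity)]
          calc (1:ℝ) ≤ 3 ^ 2 * (1 / 2) ^ 2 := by norm_num
            _ ≤ _ := by gcongr
        have h0 : 0 ≤ 1 / (π ^ 2 * r ^ 2) := by positivity
        rw [abs_le]; constructor <;> linarith
    have e2 : 2 / (t * r ^ 4) = 1 / (t * r ^ 4) + 1 / (t * r ^ 4) := by ring
    rw [hE, e2]
    rw [abs_le] at *
    constructor <;> linarith [hM.1, hM.2, g1.1, g1.2, g2.1, g2.2]

lemma phiM_meas (ρ : ℝ) : Measurable (phiM ρ) := by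
  unfold phiM
  refine Measurable.ite ?_ (by fun_prop) measurable_const
  exact (measurableSet_Ici (a := ρ)).inter (measurableSet_Iio (a := (1/2 : ℝ)))

lemma phiE_meas (ρ t : ℝ) : Measurable (phiE ρ t) := by
  unfold phiE
  refine Measurable.add (Measurable.ite (measurableSet_Iio (a := ρ)) measurable_const measurable_const)
    (Measurable.ite ?_ (by fun_prop) measurable_const)
  exact (measurableSet_Ici (a := ρ)).inter (measurableSet_Iio (a := (1 : ℝ)))

lemma phiM_integrable (ρ : ℝ) (hρ : 0 < ρ) :
    Integrable (fun p : ℝ × ℝ => phiM ρ (√(p.1 ^ 2 + p.2 ^ 2))) := by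
  have hp := Real.pi_pos
  refine radial_integrable _ (phiM_meas ρ) (1 / (32 * π ^ 2 * ρ ^ 2)) (fun r hr => ?_) fun r hr => ?_
  · unfold phiM
    split_ifs with h
    · rw [abs_of_nonneg (by positivity)]
      have := h.1
      gcongr
    · rw [abs_zero]; positivity
  · exact if_neg (by rintro ⟨_, h⟩; linarith)

lemma phiE_nonneg (ρ t r : ℝ) (ht : 0 < t) : 0 ≤ phiE ρ t r := by
  unfold phiE; split_ifs <;> positivity

lemma phiE_integrable (ρ t : ℝ) (hρ : 0 < ρ) (hρ1 : ρ < 1) (ht : 0 < t) :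
    Integrable (fun p : ℝ × ℝ => phiE ρ t (√(p.1 ^ 2 + p.2 ^ 2))) := by
  refine radial_integrable _ (phiE_meas ρ t) (20 * t + 2 / (t * ρ ^ 4)) (fun r hr => ?_) fun r hr => ?_
  · rw [abs_of_nonneg (phiE_nonneg ρ t r ht)]
    unfold phiE
    refine add_le_add ?_ ?_
    · split_ifs <;> [exact le_rfl; positivity]
    · split_ifs with h
      · have := h.1
        gcongr
      · positivity
  · unfold phiE
    rw [if_neg (by linarith), if_neg (by rintro ⟨_, h⟩; linarith), add_zero]

lemma phiM_integral (ρ : ℝ) (hρ : 0 < ρ) (hρ2 : ρ < 1 / 2) :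
    ∫ p : ℝ × ℝ, phiM ρ (√(p.1 ^ 2 + p.2 ^ 2)) = 1 / (16 * π) * Real.log ((1 / 2) / ρ) := by
  have hp := Real.pi_pos
  rw [radial_integral]
  have h : ∀ r, r * phiM ρ r = (Ico ρ (1 / 2)).indicator (fun r => 1 / (32 * π ^ 2) * r⁻¹) r := by
    intro r
    unfold phiM
    by_cases hr : ρ ≤ r ∧ r < 1 / 2
    · rw [if_pos hr, indicator_of_mem (show r ∈ Ico ρ (1 / 2) from hr)]
      have : 0 < r := by linarith [hr.1]
      field_simp
    · rw [if_neg hr, indicator_of_notMem (show r ∉ Ico ρ (1 / 2) from hr), mul_zero]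
  simp_rw [h]
  rw [setIntegral_indicator measurableSet_Ico, inter_eq_right.mpr (show Ico ρ (1 / 2) ⊆ Ioi 0 from fun r hr => lt_of_lt_of_le hρ hr.1),
    integral_Ico_eq_integral_Ioo, ← integral_Ioc_eq_integral_Ioo,
    ← intervalIntegral.integral_of_le hρ2.le, intervalIntegral.integral_const_mul,
    integral_inv_of_pos hρ (by norm_num)]
  generalize Real.log ((1 / 2) / ρ) = L
  field_simp
  ring

lemma phiE_integral (ρ t : ℝ) (hρ : 0 < ρ) (hρ1 : ρ < 1) (ht : 0 < t) (hρt : t * ρ ^ 2 = 1) :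
    ∫ p : ℝ × ℝ, phiE ρ t (√(p.1 ^ 2 + p.2 ^ 2)) ≤ 22 * π := by
  have hp := Real.pi_pos
  rw [radial_integral]
  have h : ∀ r ∈ Ioi (0:ℝ), r * phiE ρ t r = (Ioo 0 ρ).indicator (fun r => 20 * t * r) r +
      (Ico ρ 1).indicator (fun r => 2 / t * r ^ (-3 : ℤ)) r := by
    intro r hr0
    have hr0 : 0 < r := hr0
    unfold phiE
    rw [mul_add]
    congr 1
    · by_cases hr : r < ρ
      · rw [if_pos hr, indicator_of_mem (show r ∈ Ioo 0 ρ from ⟨hr0, hr⟩)]; ring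
      · rw [if_neg hr, indicator_of_notMem (fun h => hr h.2), mul_zero]
    · by_cases hr : ρ ≤ r ∧ r < 1
      · rw [if_pos hr, indicator_of_mem (show r ∈ Ico ρ 1 from hr), zpow_neg]
        norm_cast
        field_simp
      · rw [if_neg hr, indicator_of_notMem (show r ∉ Ico ρ 1 from hr), mul_zero]
  have h0 : (0:ℝ) ∉ uIcc ρ 1 := by rw [uIcc_of_le hρ1.le]; exact fun h => by linarith [h.1]
  have i1 : IntegrableOn (fun r : ℝ => 20 * t * r) (Ioo 0 ρ) :=
    (ContinuousOn.integrableOn_Icc (by fun_prop)).mono_set Ioo_subset_Icc_self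
  have i2 : IntegrableOn (fun r : ℝ => 2 / t * r ^ (-3 : ℤ)) (Ico ρ 1) := by
    refine (ContinuousOn.integrableOn_Icc ?_).mono_set Ico_subset_Icc_self
    refine continuousOn_const.mul (ContinuousOn.zpow₀ continuousOn_id _ fun r hr => Or.inl ?_)
    have : 0 < r := by linarith [hr.1]
    exact this.ne'
  rw [setIntegral_congr_fun measurableSet_Ioi h,
    integral_add ((integrable_indicator_iff measurableSet_Ioo).mpr i1).integrableOn
      ((integrable_indicator_iff measurableSet_Ico).mpr i2).integrableOn,
    setIntegral_indicator measurableSet_Ico, inter_eq_right.mpr (show Ico ρ 1 ⊆ Ioi 0 from fun r hr => lt_of_lt_of_le hρ hr.1),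
    setIntegral_indicator measurableSet_Ioo, inter_eq_right.mpr (show Ioo 0 ρ ⊆ Ioi 0 from fun r hr => hr.1),
    ← integral_Ioc_eq_integral_Ioo, ← intervalIntegral.integral_of_le hρ.le,
    integral_Ico_eq_integral_Ioo, ← integral_Ioc_eq_integral_Ioo,
    ← intervalIntegral.integral_of_le hρ1.le, intervalIntegral.integral_const_mul,
    intervalIntegral.integral_const_mul, integral_id, integral_zpow (Or.inr ⟨by norm_num, h0⟩)]
  have e1 : 20 * t * ((ρ ^ 2 - 0 ^ 2) / 2) = 10 := by linear_combination 10 * hρt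
  have e2 : 2 / t * ((1 ^ ((-3 : ℤ) + 1) - ρ ^ ((-3 : ℤ) + 1)) / (((-3 : ℤ) : ℝ) + 1)) ≤ 1 := by
    have : ρ ^ ((-3 : ℤ) + 1) = t := by
      rw [show ((-3 : ℤ) + 1) = -2 by norm_num, zpow_neg]
      norm_cast
      exact inv_eq_of_mul_eq_one_left hρt
    rw [this, one_zpow]
    push_cast
    rw [div_mul_eq_mul_div, div_le_one ht]
    norm_num
    linarith
  rw [e1]
  nlinarith

abbrev muQ : Measure ℝ := volume.restrict (Ioc (-(1/2)) (-(1/2) + 1))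

lemma sin2_coe (x : ℝ) : sin2 (x : Torus) = Real.sin (π * x) ^ 2 := rfl

lemma sincos_coe (x : ℝ) : sincos (x : Torus) = Real.sin (π * x) * Real.cos (π * x) := rfl

lemma sin2_meas : Measurable sin2 := by
  have : Continuous sin2 := continuous_coinduced_dom.mpr
    (by exact (by fun_prop : Continuous fun x : ℝ => Real.sin (π * x) ^ 2))
  exact this.measurable

lemma sincos_meas : Measurable sincos := by
  have : Continuous sincos := continuous_coinduced_dom.mpr
    (by exact (by fun_prop : Continuous fun x : ℝ => Real.sin (π * x) * Real.cos (π * x)))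
  exact this.measurable

lemma Phi_meas : Measurable Phi := by
  unfold Phi
  exact ((sin2_meas.comp measurable_fst).add (sin2_meas.comp measurable_snd)).const_mul _

lemma psi_meas : Measurable (psiC 0) := by
  unfold psiC vel
  refine Measurable.div (Measurable.div (sincos_meas.comp measurable_fst) ?_) Phi_meas
  exact ((sin2_meas.comp measurable_fst).add (sin2_meas.comp measurable_snd)).sqrt

lemma reduce (t : ℝ) :
    ∫ k, HH t (psiC 0 k) ∂piM = ∫ p, gg t p.1 p.2 ∂(muQ.prod muQ) := by
  unfold piM
  rw [integral_withDensity_eq_integral_toReal_smul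
    ((Phi_meas.const_mul _).ennreal_ofReal) (Eventually.of_forall fun _ => ENNReal.ofReal_lt_top)]
  have hmp := (AddCircle.measurePreserving_mk 1 (-(1/2))).prod (AddCircle.measurePreserving_mk 1 (-(1/2)))
  rw [Measure.volume_eq_prod, ← hmp.map_eq, integral_map hmp.measurable.aemeasurable]
  · refine integral_congr_ae (Eventually.of_forall fun p => ?_)
    have h1 : Phi (Prod.map QuotientAddGroup.mk QuotientAddGroup.mk p) = 8 * SS p.1 p.2 := rfl
    have h2 : psiC 0 (Prod.map QuotientAddGroup.mk QuotientAddGroup.mk p) = PP p.1 p.2 := rfl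
    simp only [h1, h2]
    rw [ENNReal.toReal_ofReal (by linarith [SS_nonneg p.1 p.2]), smul_eq_mul]
    unfold gg; ring
  · exact (Measurable.smul ((Phi_meas.const_mul _).ennreal_ofReal.ennreal_toReal)
      ((HH_meas t).comp psi_meas)).aestronglyMeasurable

lemma key (t ρ : ℝ) (ht : 0 < t) (hρ : 0 < ρ) (hρ2 : ρ < 1 / 2) (hρt : t * ρ ^ 2 = 1) :
    |(∫ k, HH t (psiC 0 k) ∂piM) - 1 / (32 * π) * Real.log ((1 / 2) / ρ)| ≤ 1 / 2 + 11 * π := by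
  rw [reduce]
  set I := ∫ p, gg t p.1 p.2 ∂(muQ.prod muQ) with hI
  have : IsProbabilityMeasure muQ := ⟨by simp [muQ]⟩
  have hI2 : ∫ p, gg t p.2 p.1 ∂(muQ.prod muQ) = I :=
    integral_prod_swap (μ := muQ) (ν := muQ) (fun p => gg t p.1 p.2)
  have hb : ∀ x y, ‖gg t x y‖ ≤ 2 * t ^ 2 := fun x y => by
    rw [Real.norm_eq_abs, abs_of_nonneg (gg_nonneg _ _ _)]
    exact (gg_le t x y ht.le).trans (by gcongr; exact SS_le_two x y)
  have ig1 : Integrable (fun p : ℝ × ℝ => gg t p.1 p.2) (muQ.prod muQ) :=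
    Integrable.of_bound (gg_meas t).aestronglyMeasurable _ (Eventually.of_forall fun p => hb _ _)
  have ig2 : Integrable (fun p : ℝ × ℝ => gg t p.2 p.1) (muQ.prod muQ) :=
    Integrable.of_bound ((gg_meas t).comp measurable_swap).aestronglyMeasurable _
      (Eventually.of_forall fun p => hb _ _)
  have hν : muQ.prod muQ = (volume : Measure (ℝ × ℝ)).restrict
      (Ioc (-(1/2)) (-(1/2) + 1) ×ˢ Ioc (-(1/2)) (-(1/2) + 1)) := by
    rw [Measure.prod_restrict, ← Measure.volume_eq_prod]
  have iM : Integrable (fun p : ℝ × ℝ => phiM ρ (√(p.1 ^ 2 + p.2 ^ 2))) (muQ.prod muQ) := by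
    rw [hν]; exact (phiM_integrable ρ hρ).restrict
  have iE : Integrable (fun p : ℝ × ℝ => phiE ρ t (√(p.1 ^ 2 + p.2 ^ 2))) (muQ.prod muQ) := by
    rw [hν]; exact (phiE_integrable ρ t hρ (by linarith) ht).restrict
  have hM : ∫ p, phiM ρ (√(p.1 ^ 2 + p.2 ^ 2)) ∂(muQ.prod muQ)
      = 1 / (16 * π) * Real.log ((1 / 2) / ρ) := by
    rw [← phiM_integral ρ hρ hρ2, hν]
    refine setIntegral_eq_integral_of_forall_compl_eq_zero fun p hp => if_neg ?_
    rintro ⟨_, h⟩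
    apply hp
    rw [Real.sqrt_lt' (by norm_num)] at h
    have h1 := abs_lt.mp (abs_lt_of_sq_lt_sq (a := p.1) (b := 1/2) (by nlinarith [sq_nonneg p.2]) (by norm_num))
    have h2 := abs_lt.mp (abs_lt_of_sq_lt_sq (a := p.2) (b := 1/2) (by nlinarith [sq_nonneg p.1]) (by norm_num))
    exact ⟨⟨h1.1, by linarith [h1.2]⟩, ⟨h2.1, by linarith [h2.2]⟩⟩
  have hE : ∫ p, phiE ρ t (√(p.1 ^ 2 + p.2 ^ 2)) ∂(muQ.prod muQ) ≤ 22 * π := by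
    refine le_trans ?_ (phiE_integral ρ t hρ (by linarith) ht hρt)
    rw [hν]
    exact setIntegral_le_integral (phiE_integrable ρ t hρ (by linarith) ht)
      (Eventually.of_forall fun p => phiE_nonneg _ _ _ ht)
  have hae : ∀ᵐ p ∂(muQ.prod muQ), ‖gg t p.1 p.2 + gg t p.2 p.1 - phiM ρ (√(p.1 ^ 2 + p.2 ^ 2))‖
      ≤ 1 + phiE ρ t (√(p.1 ^ 2 + p.2 ^ 2)) := by
    rw [hν]
    filter_upwards [ae_restrict_mem (measurableSet_Ioc.prod measurableSet_Ioc)] with p hp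
    exact pointwise t ρ p.1 p.2 ht hρ hρt
      (abs_le.mpr ⟨hp.1.1.le, by linarith [hp.1.2]⟩) (abs_le.mpr ⟨hp.2.1.le, by linarith [hp.2.2]⟩)
  have hfin := norm_integral_le_of_norm_le ((integrable_const (1:ℝ)).add iE) hae
  have ig : Integrable (fun p : ℝ × ℝ => gg t p.1 p.2 + gg t p.2 p.1) (muQ.prod muQ) := ig1.add ig2
  rw [integral_sub ig iM, integral_add ig1 ig2, hI2, ← hI, hM] at hfin
  have h2 : ∫ p : ℝ × ℝ, (1 + phiE ρ t (√(p.1 ^ 2 + p.2 ^ 2))) ∂(muQ.prod muQ) ≤ 1 + 22 * π := by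
    rw [integral_add (integrable_const (1:ℝ)) iE]
    simp only [integral_const, probReal_univ, one_smul]
    linarith
  have h3 := hfin.trans h2
  rw [Real.norm_eq_abs, abs_le] at h3
  have e : 1 / (16 * π) * Real.log ((1 / 2) / ρ) = 2 * (1 / (32 * π) * Real.log ((1 / 2) / ρ)) := by
    ring
  rw [e] at h3
  rw [abs_le]
  constructor <;> linarith [h3.1, h3.2]

lemma final_limit (F : ℕ → ℝ) (c d C : ℝ)
    (h : ∀ᶠ N : ℕ in atTop, |F N - (c * Real.log N + d)| ≤ C) :
    Tendsto (fun N : ℕ => (Real.log N)⁻¹ * F N) atTop (nhds c) := by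
  have hl : Tendsto (fun N : ℕ => Real.log N) atTop atTop :=
    Real.tendsto_log_atTop.comp tendsto_natCast_atTop_atTop
  have hi := hl.inv_tendsto_atTop
  have h0 : Tendsto (fun N : ℕ => (Real.log N)⁻¹ * (C + |d|)) atTop (nhds 0) := by
    simpa using hi.mul_const (C + |d|)
  rw [tendsto_iff_norm_sub_tendsto_zero]
  refine squeeze_zero' (Eventually.of_forall fun _ => norm_nonneg _) ?_ h0
  filter_upwards [h, hl.eventually_gt_atTop 0] with N hN hlog
  have e : (Real.log N)⁻¹ * F N - c = (Real.log N)⁻¹ * ((F N - (c * Real.log N + d)) + d) := by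
    field_simp; ring
  rw [e, norm_mul, Real.norm_eq_abs, abs_of_pos (inv_pos.mpr hlog)]
  gcongr
  exact (abs_add_le _ _).trans (by gcongr)

/-- The limit defining `σ²` exists and equals `1/(128π)`:
`σ² = lim_N (1/ln N) ∫ π(dk) ∫_0^∞ e^{-z} z² ψ¹(k)² 𝟙{z|ψ¹(k)| ≤ √N} dz = 1/(128π)`. -/
theorem sigma2_limit :
    Tendsto (fun N : ℕ =>
      (Real.log N)⁻¹ * ∫ k, (∫ z in Set.Ioi (0:ℝ),
        Real.exp (-z) * (z * psiC 0 k) ^ 2 *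
          (if z * |psiC 0 k| ≤ Real.sqrt N then 1 else 0)) ∂piM)
      atTop (nhds (1 / (128 * π))) := by
  refine final_limit (fun N : ℕ => ∫ k, HH (√N) (psiC 0 k) ∂piM) (1 / (128 * π))
    (- (1 / (32 * π) * Real.log 2)) (1 / 2 + 11 * π) ?_
  filter_upwards [eventually_gt_atTop 16] with N hN
  have hN' : (16:ℝ) < N := by exact_mod_cast hN
  have ht : 4 < √(N:ℝ) := by rw [Real.lt_sqrt (by norm_num)]; linarith
  have hs : 2 < √√(N:ℝ) := by rw [Real.lt_sqrt (by norm_num)]; linarith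
  have hs2 : √√(N:ℝ) ^ 2 = √(N:ℝ) := Real.sq_sqrt (by positivity)
  have hk := key (√N) (√√N)⁻¹ (by linarith) (by positivity)
    (by rw [inv_lt_comm₀ (by positivity) (by norm_num)]; linarith)
    (by rw [inv_pow, hs2]; exact mul_inv_cancel₀ (by positivity))
  have hl : Real.log ((1 / 2) / (√√(N:ℝ))⁻¹) = Real.log N / 4 - Real.log 2 := by
    rw [div_inv_eq_mul, Real.log_mul (by norm_num) (by positivity), Real.log_sqrt (by positivity),
      Real.log_sqrt (by positivity), one_div, Real.log_inv]
    ring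
  rw [hl] at hk
  have hp := Real.pi_pos
  have e : 1 / (32 * π) * (Real.log N / 4 - Real.log 2)
      = 1 / (128 * π) * Real.log N + - (1 / (32 * π) * Real.log 2) := by
    field_simp; ring
  rw [e] at hk
  exact hk

end
end

section
/- Central limit theorem for bounded triangular arrays via moments: let {X̄_{n,i} : 1 ≤ i ≤ n, n ≥ 1} be an array of centered random variables and suppose there exists a sequence ε_n ↓ 0 with |X̄_{n,i}| ≤ ε_n for all n and i. Let S̄_n = ∑_{i=1}^n X̄_{n,i} and c ≥ 0. If (i) for every ℓ ≥ 1 and every sequence of positive integers (p₁,…,p_ℓ) with p_j = 1 for some j, ∑_{i₁≠i₂≠…≠i_ℓ ≤ n} E[(X̄_{n,i₁})^{p₁}⋯(X̄_{n,i_ℓ})^{p_ℓ}] → 0 as n → ∞, and (ii) for every ℓ ≥ 1, ∑_{i₁≠i₂≠…≠i_ℓ ≤ n} E[(X̄_{n,i₁})²⋯(X̄_{n,i_ℓ})²] → c^ℓ as n → ∞, then S̄_n converges in distribution to the Gaussian law N(0,c). -/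
open MeasureTheory Filter
open scoped ENNReal NNReal Classical

noncomputable section

namespace CltMoments

/-- Sharp Taylor bound for the complex exponential on the imaginary axis. -/
lemma taylor_bound_nonneg (n : ℕ) : ∀ x : ℝ, 0 ≤ x →
    ‖Complex.exp (x * Complex.I) - ∑ k ∈ Finset.range n, (x * Complex.I) ^ k / (k.factorial : ℂ)‖
      ≤ x ^ n / n.factorial := by
  induction n with
  | zero => intro x hx; simp [Complex.norm_exp_ofReal_mul_I]
  | succ n ih =>
    intro x hx
    have hderiv : ∀ y : ℝ, HasDerivAt (fun y : ℝ => Complex.exp (y * Complex.I)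
        - ∑ k ∈ Finset.range (n+1), (y * Complex.I) ^ k / (k.factorial : ℂ))
        ((Complex.exp (y * Complex.I)
          - ∑ k ∈ Finset.range n, (y * Complex.I) ^ k / (k.factorial : ℂ)) * Complex.I) y := by
      intro y
      have h1 : HasDerivAt (fun y : ℝ => (y : ℂ) * Complex.I) Complex.I y := by
        simpa using (Complex.ofRealCLM.hasDerivAt (x := y)).mul_const Complex.I
      have h2 := h1.cexp
      have h3 : HasDerivAt (fun y : ℝ => ∑ k ∈ Finset.range (n+1),
          (y * Complex.I) ^ k / (k.factorial : ℂ))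
          (∑ k ∈ Finset.range (n+1),
            ((k : ℂ) * (y * Complex.I) ^ (k-1) * Complex.I) / (k.factorial : ℂ)) y := by
        apply HasDerivAt.fun_sum
        intro k _
        exact (h1.pow k).div_const _
      refine (h2.sub h3).congr_deriv ?_
      symm
      rw [Finset.sum_range_succ', sub_mul, Finset.sum_mul]
      simp only [Nat.cast_zero, zero_mul, zero_div, add_zero, Nat.add_sub_cancel]
      congr 1
      apply Finset.sum_congr rfl
      intro k _
      rw [Nat.factorial_succ]
      push_cast
      have : ((k : ℂ) + 1) ≠ 0 := by exact_mod_cast Nat.succ_ne_zero k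
      have : (k.factorial : ℂ) ≠ 0 := by exact_mod_cast Nat.factorial_ne_zero k
      field_simp
    have hB : ∀ y : ℝ, HasDerivAt (fun y : ℝ => y ^ (n+1) / ((n+1).factorial : ℝ))
        (y ^ n / n.factorial) y := by
      intro y
      refine ((hasDerivAt_pow (n+1) y).div_const ((n+1).factorial : ℝ)).congr_deriv ?_
      rw [Nat.factorial_succ]
      push_cast
      have : ((n : ℝ) + 1) ≠ 0 := by positivity
      have : (n.factorial : ℝ) ≠ 0 := by positivity
      field_simp
      try simp
    refine image_norm_le_of_norm_deriv_right_le_deriv_boundary (a := 0) (b := x)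
      (fun y _ => (hderiv y).continuousAt.continuousWithinAt)
      (fun y _ => (hderiv y).hasDerivWithinAt) ?_ hB ?_ ⟨hx, le_refl x⟩
    · rw [Finset.sum_range_succ']
      simp
    · intro y hy
      rw [norm_mul, Complex.norm_I, mul_one]
      exact ih y hy.1

lemma taylor_bound (n : ℕ) (x : ℝ) :
    ‖Complex.exp (x * Complex.I) - ∑ k ∈ Finset.range n, (x * Complex.I) ^ k / (k.factorial : ℂ)‖
      ≤ |x| ^ n / n.factorial := by
  rcases le_total 0 x with h | h
  · rw [abs_of_nonneg h]; exact taylor_bound_nonneg n x h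
  · have := taylor_bound_nonneg n (-x) (by linarith)
    rw [abs_of_nonpos h]
    rw [← Complex.norm_conj] 
    convert this using 2
    simp [← Complex.exp_conj]

/-- The moments of the limit. -/
def mom (c : ℝ) : ℕ → ℝ
  | 0 => 1
  | 1 => 0
  | (j+2) => c * (j+1) * mom c j

/-- Mixed moments. -/
def mix (c : ℝ) : ℕ → ℕ → ℝ
  | 0, a => if a = 0 then 1 else 0
  | (k+1), a => mix c k (a+1) + a * c * mix c k (a-1)

lemma mix_eq (c : ℝ) : ∀ k a, mix c k a = (k.descFactorial a : ℝ) * c ^ a * mom c (k - a) := by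
  intro k
  induction k with
  | zero =>
    intro a
    cases a with
    | zero => simp [mix, mom]
    | succ a => simp [mix]
  | succ k ih =>
    intro a
    rw [mix, ih, ih]
    cases a with
    | zero =>
      cases k with
      | zero => simp [mom]
      | succ k => simp [mom]; left; ring
    | succ a =>
      simp only [Nat.add_sub_cancel]
      rw [Nat.succ_descFactorial_succ k a]
      rcases lt_trichotomy k (a) with h | h | h
      · rw [Nat.descFactorial_eq_zero_iff_lt.2 h, Nat.descFactorial_eq_zero_iff_lt.2 (by omega : k < a + 1 + 1)]
        simp
      · subst h
        rw [Nat.descFactorial_eq_zero_iff_lt.2 (by omega : k < k + 1 + 1)]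
        simp [mom]; ring
      · obtain ⟨j, rfl⟩ := Nat.exists_eq_add_of_lt h
        rw [Nat.descFactorial_succ (a+j+1) (a+1), Nat.descFactorial_succ (a+j+1) a]
        have e1 : a + j + 1 - (a + 1) = j := by omega
        have e2 : a + j + 1 - a = j + 1 := by omega
        have e3 : a + j + 1 + 1 - (a + 1) = j + 1 := by omega
        have e4 : a + j + 1 - (a + 1 + 1) = j - 1 := by omega
        rw [e1, e2, e3, e4]
        cases j with
        | zero => simp [mom]
        | succ j => simp [mom]; ring

lemma mix_zero (c : ℝ) (k : ℕ) : mix c k 0 = mom c k := by simp [mix_eq]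

lemma mom_even (c : ℝ) (j : ℕ) : mom c (2*j) / (2*j).factorial = (c/2)^j / j.factorial := by
  induction j with
  | zero => simp [mom]
  | succ j ih =>
    have : 2 * (j+1) = 2*j+2 := by ring
    rw [this, mom, Nat.factorial_succ, Nat.factorial_succ, Nat.factorial_succ j, pow_succ]
    have h1 : ((2*j).factorial : ℝ) ≠ 0 := by positivity
    have h2 : (j.factorial : ℝ) ≠ 0 := by positivity
    rw [div_eq_div_iff h1 h2] at ih
    push_cast
    have h3 : (j : ℝ) + 1 ≠ 0 := by positivity
    have h4 : 2 * (j : ℝ) + 1 + 1 ≠ 0 := by positivity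
    have h5 : 2 * (j : ℝ) + 1 ≠ 0 := by positivity
    rw [div_eq_div_iff (by positivity) (by positivity)]
    linear_combination (c * (2 * j + 1) * (j+1)) * ih

lemma mom_odd (c : ℝ) (j : ℕ) : mom c (2*j+1) = 0 := by
  induction j with
  | zero => simp [mom]
  | succ j ih =>
    have : 2 * (j+1) + 1 = (2*j+1)+2 := by ring
    rw [this, mom, ih]; simp

lemma partial_sum (c t : ℝ) (M : ℕ) :
    ∑ k ∈ Finset.range (2*M), (t * Complex.I) ^ k / (k.factorial : ℂ) * (mom c k : ℂ)
      = ∑ j ∈ Finset.range M, (-(c * t^2/2 : ℝ) : ℂ) ^ j / (j.factorial : ℂ) := by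
  induction M with
  | zero => simp
  | succ M ih =>
    have : 2 * (M+1) = 2*M+1+1 := by ring
    rw [this, Finset.sum_range_succ, Finset.sum_range_succ, ih, Finset.sum_range_succ, mom_odd]
    have h := mom_even c M
    have h' : (mom c (2*M) : ℂ) / ((2*M).factorial : ℂ) = ((c:ℂ)/2)^M / (M.factorial : ℂ) := by
      exact_mod_cast congrArg (fun x : ℝ => (x : ℂ)) h
    have h2 : ((t:ℂ) * Complex.I) ^ (2*M) = (-(t:ℂ)^2)^M := by
      rw [pow_mul, mul_pow, Complex.I_sq]; ring
    rw [div_mul_eq_mul_div, mul_div_assoc ((_ : ℂ) ^ (2*M)), h', h2]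
    rw [Complex.ofReal_zero, mul_zero, add_zero, ← mul_div_assoc, ← mul_pow]
    push_cast
    congr 3
    ring

/-- Sum over injective tuples. -/
def A (x : ℕ → ℝ) (n ℓ : ℕ) (p : Fin ℓ → ℕ) : ℝ :=
  ∑ i ∈ (Fintype.piFinset fun _ : Fin ℓ => Finset.Icc 1 n).filter
    (fun i => Function.Injective i), ∏ j, x (i j) ^ p j

lemma A_mul (x : ℕ → ℝ) (n ℓ : ℕ) (p : Fin ℓ → ℕ) :
    (∑ i ∈ Finset.Icc 1 n, x i) * A x n ℓ p
      = A x n (ℓ+1) (Fin.cons 1 p : Fin (ℓ+1) → ℕ)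
        + ∑ j, A x n ℓ (fun i => p i + if i = j then 1 else 0) := by
  have h1 : A x n (ℓ+1) (Fin.cons 1 p : Fin (ℓ+1) → ℕ) =
      ∑ i ∈ (Fintype.piFinset fun _ : Fin ℓ => Finset.Icc 1 n).filter
        (fun i => Function.Injective i),
        ∑ y ∈ (Finset.Icc 1 n).filter (fun y => y ∉ Set.range i), x y * ∏ j, x (i j) ^ p j := by
    rw [A, Finset.sum_sigma']
    refine Finset.sum_bij' (fun i _ => ⟨Fin.tail i, i 0⟩)
      (fun q _ => (Fin.cons q.2 q.1 : Fin (ℓ+1) → ℕ)) ?_ ?_ ?_ ?_ ?_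
    · intro i hi
      rw [Finset.mem_filter, Fintype.mem_piFinset] at hi
      obtain ⟨h, hinj⟩ := hi
      rw [← Fin.cons_self_tail i, Fin.cons_injective_iff] at hinj
      simp only [Finset.mem_sigma, Finset.mem_filter, Fintype.mem_piFinset]
      exact ⟨⟨fun j => h j.succ, hinj.2⟩, h 0, hinj.1⟩
    · intro q hq
      simp only [Finset.mem_sigma, Finset.mem_filter, Fintype.mem_piFinset] at hq
      rw [Finset.mem_filter, Fintype.mem_piFinset, Fin.cons_injective_iff]
      refine ⟨fun j => ?_, hq.2.2, hq.1.2⟩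
      refine Fin.cases ?_ (fun j => ?_) j
      · simpa using hq.2.1
      · simpa using hq.1.1 j
    · intro i _; simp
    · intro q _; simp
    · intro i _
      rw [Fin.prod_univ_succ]
      simp [Fin.tail]
  have h2 : ∑ j, A x n ℓ (fun i => p i + if i = j then 1 else 0) =
      ∑ i ∈ (Fintype.piFinset fun _ : Fin ℓ => Finset.Icc 1 n).filter
        (fun i => Function.Injective i),
        ∑ y ∈ (Finset.Icc 1 n).filter (fun y => ¬ (y ∉ Set.range i)),
          x y * ∏ j, x (i j) ^ p j := by
    simp only [A]
    rw [Finset.sum_comm]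
    apply Finset.sum_congr rfl
    intro i hi
    rw [Finset.mem_filter, Fintype.mem_piFinset] at hi
    have : (Finset.Icc 1 n).filter (fun y => ¬ (y ∉ Set.range i)) = Finset.univ.image i := by
      ext y
      simp only [Finset.mem_filter, not_not, Set.mem_range, Finset.mem_image, Finset.mem_univ,
        true_and]
      constructor
      · exact fun h => h.2
      · rintro ⟨j, rfl⟩
        exact ⟨hi.1 j, j, rfl⟩
    rw [this, Finset.sum_image (fun a _ b _ h => hi.2 h)]
    apply Finset.sum_congr rfl
    intro j _
    simp only [pow_add, Finset.prod_mul_distrib]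
    rw [mul_comm]
    congr 1
    simp [pow_ite, Finset.prod_ite_eq']
  rw [h1, h2, ← Finset.sum_add_distrib, A, Finset.mul_sum]
  apply Finset.sum_congr rfl
  intro i _
  rw [Finset.sum_filter_add_sum_filter_not, Finset.sum_mul]

/-- Limit functional. -/
def Lim (c : ℝ) (k ℓ : ℕ) (p : Fin ℓ → ℕ) : ℝ :=
  if ∃ j, 3 ≤ p j then 0 else
    c ^ (Finset.univ.filter (fun j => p j = 2)).card *
      mix c k (Finset.univ.filter (fun j => p j = 1)).card

lemma Lim_succ (c : ℝ) (k ℓ : ℕ) (p : Fin ℓ → ℕ) (hp : ∀ j, 1 ≤ p j) :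
    Lim c (k+1) ℓ p = Lim c k (ℓ+1) (Fin.cons 1 p : Fin (ℓ+1) → ℕ)
      + ∑ j, Lim c k ℓ (fun i => p i + if i = j then 1 else 0) := by
  by_cases h : ∃ j, 3 ≤ p j
  · obtain ⟨j, hj⟩ := h
    have h1 : Lim c (k+1) ℓ p = 0 := if_pos ⟨j, hj⟩
    have h2 : Lim c k (ℓ+1) (Fin.cons 1 p : Fin (ℓ+1) → ℕ) = 0 :=
      if_pos ⟨j.succ, by simpa using hj⟩
    rw [h1, h2, Finset.sum_eq_zero, zero_add]
    intro i _
    exact if_pos ⟨j, le_trans hj (Nat.le_add_right _ _)⟩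
  · have h1 : Lim c (k+1) ℓ p = c ^ (Finset.univ.filter (fun j => p j = 2)).card *
      mix c (k+1) (Finset.univ.filter (fun j => p j = 1)).card := if_neg h
    push Not at h
    have h2 : Lim c k (ℓ+1) (Fin.cons 1 p : Fin (ℓ+1) → ℕ) =
        c ^ (Finset.univ.filter (fun j => p j = 2)).card *
      mix c k ((Finset.univ.filter (fun j => p j = 1)).card + 1) := by
      unfold Lim
      rw [if_neg]
      · congr 2
        · rw [Fin.card_filter_univ_succ]; simp
        · rw [Fin.card_filter_univ_succ]; simp
      · rintro ⟨j, hj⟩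
        revert hj
        refine Fin.cases ?_ (fun j => ?_) j
        · simp
        · simp [h j]
    have h3 : ∀ j, Lim c k ℓ (fun i => p i + if i = j then 1 else 0) =
        if p j = 1 then c ^ ((Finset.univ.filter (fun j => p j = 2)).card + 1) *
          mix c k ((Finset.univ.filter (fun j => p j = 1)).card - 1) else 0 := by
      intro j
      have hj2 := h j
      have hj1 := hp j
      by_cases hj : p j = 1
      · rw [if_pos hj, Lim, if_neg]
        · congr 2
          · have : (Finset.univ.filter (fun i => p i + (if i = j then 1 else 0) = 2))
              = insert j (Finset.univ.filter (fun j => p j = 2)) := by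
              ext i
              by_cases hij : i = j
              · subst hij; simp [hj]
              · simp [hij]
            rw [this, Finset.card_insert_of_notMem (by simp [hj])]
          · have : (Finset.univ.filter (fun i => p i + (if i = j then 1 else 0) = 1))
              = (Finset.univ.filter (fun j => p j = 1)).erase j := by
              ext i
              by_cases hij : i = j
              · subst hij; simp [hj]
              · simp [hij]
            rw [this, Finset.card_erase_of_mem (by simp [hj])]
        · rintro ⟨i, hi⟩
          have := h i
          by_cases hij : i = j
          · subst hij; simp [hj] at hi
          · simp [hij] at hi; omega
      · rw [if_neg hj, Lim, if_pos]
        exact ⟨j, by simp; omega⟩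
    rw [h1, h2]
    simp_rw [h3]
    rw [← Finset.sum_filter, Finset.sum_const, mix, nsmul_eq_mul]
    ring

/-- Bounded measurable functions. -/
def Bd {Ω : Type} [MeasurableSpace Ω] (f : Ω → ℝ) : Prop :=
  Measurable f ∧ ∃ C, ∀ ω, |f ω| ≤ C

section
variable {Ω : Type} [MeasurableSpace Ω]

lemma Bd.integrable {f : Ω → ℝ} (h : Bd f) (Pr : Measure Ω) [IsProbabilityMeasure Pr] :
    Integrable f Pr := by
  obtain ⟨hm, C, hC⟩ := h
  exact Integrable.of_bound hm.aestronglyMeasurable C (ae_of_all _ hC)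

lemma Bd.mul {f g : Ω → ℝ} (hf : Bd f) (hg : Bd g) : Bd (fun ω => f ω * g ω) := by
  obtain ⟨hm, C, hC⟩ := hf
  obtain ⟨hm', C', hC'⟩ := hg
  refine ⟨hm.mul hm', C * C', fun ω => ?_⟩
  rw [abs_mul]
  exact mul_le_mul (hC ω) (hC' ω) (abs_nonneg _) ((abs_nonneg _).trans (hC ω))

lemma Bd.add {f g : Ω → ℝ} (hf : Bd f) (hg : Bd g) : Bd (fun ω => f ω + g ω) := by
  obtain ⟨hm, C, hC⟩ := hf
  obtain ⟨hm', C', hC'⟩ := hg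
  exact ⟨hm.add hm', C + C', fun ω => (abs_add_le _ _).trans (add_le_add (hC ω) (hC' ω))⟩

lemma Bd.const (a : ℝ) : Bd (fun _ : Ω => a) := ⟨measurable_const, |a|, fun _ => le_rfl⟩

lemma Bd.pow {f : Ω → ℝ} (hf : Bd f) (k : ℕ) : Bd (fun ω => f ω ^ k) := by
  induction k with
  | zero => simpa using Bd.const 1
  | succ k ih => simpa [pow_succ] using ih.mul hf

lemma Bd.sum {ι : Type} (s : Finset ι) {f : ι → Ω → ℝ} (h : ∀ i ∈ s, Bd (f i)) :
    Bd (fun ω => ∑ i ∈ s, f i ω) := by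
  induction s using Finset.induction_on with
  | empty => simpa using Bd.const 0
  | insert a s ha ih =>
    simp only [Finset.sum_insert ha]
    exact (h a (by simp)).add (ih fun i hi => h i (by simp [hi]))

lemma Bd.prod {ι : Type} (s : Finset ι) {f : ι → Ω → ℝ} (h : ∀ i ∈ s, Bd (f i)) :
    Bd (fun ω => ∏ i ∈ s, f i ω) := by
  induction s using Finset.induction_on with
  | empty => simpa using Bd.const 1
  | insert a s ha ih =>
    simp only [Finset.prod_insert ha]
    exact (h a (by simp)).mul (ih fun i hi => h i (by simp [hi]))

lemma Bd.A {X : ℕ → Ω → ℝ} {n : ℕ} (h : ∀ i ∈ Finset.Icc 1 n, Bd (X i)) (ℓ : ℕ)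
    (p : Fin ℓ → ℕ) : Bd (fun ω => A (fun i => X i ω) n ℓ p) := by
  unfold CltMoments.A
  refine Bd.sum _ fun i hi => Bd.prod _ fun j _ => Bd.pow (h _ ?_) _
  rw [Finset.mem_filter, Fintype.mem_piFinset] at hi
  exact hi.1 j

lemma integral_A (Pr : Measure Ω) [IsProbabilityMeasure Pr]
    {X : ℕ → Ω → ℝ} {n : ℕ} (h : ∀ i ∈ Finset.Icc 1 n, Bd (X i)) (ℓ : ℕ)
    (p : Fin ℓ → ℕ) : ∫ ω, A (fun i => X i ω) n ℓ p ∂Pr =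
      ∑ i ∈ (Fintype.piFinset fun _ : Fin ℓ => Finset.Icc 1 n).filter
              (fun i => Function.Injective i),
            ∫ ω, ∏ j, X (i j) ω ^ p j ∂Pr := by
  unfold CltMoments.A
  rw [integral_finsetSum]
  intro i hi
  refine Bd.integrable (Bd.prod _ fun j _ => Bd.pow (h _ ?_) _) Pr
  rw [Finset.mem_filter, Fintype.mem_piFinset] at hi
  exact hi.1 j

lemma A_bound (x : ℕ → ℝ) (n ℓ : ℕ) (p : Fin ℓ → ℕ) (e : ℝ) (he1 : e ≤ 1)
    (hx : ∀ i ∈ Finset.Icc 1 n, |x i| ≤ e) (hp : ∀ j, 2 ≤ p j) (hp3 : ∃ j, 3 ≤ p j) :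
    |A x n ℓ p| ≤ e * A x n ℓ (fun _ => 2) := by
  unfold A
  rw [Finset.mul_sum]
  refine (Finset.abs_sum_le_sum_abs _ _).trans (Finset.sum_le_sum fun i hi => ?_)
  rw [Finset.mem_filter, Fintype.mem_piFinset] at hi
  obtain ⟨j0, hj0⟩ := hp3
  have hx' : ∀ j, |x (i j)| ≤ e := fun j => hx _ (hi.1 j)
  rw [Finset.abs_prod, ← Finset.mul_prod_erase _ _ (Finset.mem_univ j0),
    ← Finset.mul_prod_erase _ _ (Finset.mem_univ j0), ← mul_assoc]
  have he0 : 0 ≤ e := (abs_nonneg _).trans (hx' j0)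
  refine mul_le_mul ?_ ?_ (Finset.prod_nonneg fun _ _ => abs_nonneg _) (mul_nonneg he0 (sq_nonneg _))
  · rw [abs_pow, ← sq_abs (x (i j0))]
    calc |x (i j0)| ^ p j0 ≤ |x (i j0)| ^ 3 :=
          pow_le_pow_of_le_one (abs_nonneg _) ((hx' j0).trans he1) hj0
      _ = |x (i j0)| * |x (i j0)| ^ 2 := by ring
      _ ≤ _ := mul_le_mul_of_nonneg_right (hx' j0) (by positivity)
  · refine Finset.prod_le_prod (fun _ _ => abs_nonneg _) fun j _ => ?_
    rw [abs_pow, ← sq_abs (x (i j))]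
    exact pow_le_pow_of_le_one (abs_nonneg _) ((hx' j).trans he1) (hp j)

lemma moments (Pr : Measure Ω) [IsProbabilityMeasure Pr]
    (Xb : ℕ → ℕ → Ω → ℝ) (hmeas : ∀ n i, Measurable (Xb n i))
    (eps : ℕ → ℝ) (heps_lim : Tendsto eps atTop (nhds 0))
    (hbdd : ∀ n i, i ∈ Finset.Icc 1 n → ∀ ω, |Xb n i ω| ≤ eps n)
    (c : ℝ)
    (hsingleton : ∀ (ℓ : ℕ) (pvec : Fin (ℓ + 1) → ℕ),
      (∀ j, 1 ≤ pvec j) → (∃ j, pvec j = 1) →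
      Tendsto (fun n : ℕ =>
          ∑ i ∈ (Fintype.piFinset fun _ : Fin (ℓ + 1) => Finset.Icc 1 n).filter
              (fun i => Function.Injective i),
            ∫ ω, ∏ j, Xb n (i j) ω ^ pvec j ∂Pr)
        atTop (nhds 0))
    (hsquares : ∀ ℓ : ℕ,
      Tendsto (fun n : ℕ =>
          ∑ i ∈ (Fintype.piFinset fun _ : Fin (ℓ + 1) => Finset.Icc 1 n).filter
              (fun i => Function.Injective i),
            ∫ ω, ∏ j, Xb n (i j) ω ^ 2 ∂Pr)
        atTop (nhds (c ^ (ℓ + 1)))) (k : ℕ) :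
    ∀ (ℓ : ℕ) (p : Fin ℓ → ℕ), (∀ j, 1 ≤ p j) →
      Tendsto (fun n : ℕ => ∫ ω, (∑ i ∈ Finset.Icc 1 n, Xb n i ω) ^ k *
        A (fun i => Xb n i ω) n ℓ p ∂Pr) atTop (nhds (Lim c k ℓ p)) := by
  have hB : ∀ n, ∀ i ∈ Finset.Icc 1 n, Bd (Xb n i) :=
    fun n i hi => ⟨hmeas n i, eps n, hbdd n i hi⟩
  have hS : ∀ n, Bd (fun ω => ∑ i ∈ Finset.Icc 1 n, Xb n i ω) := fun n => Bd.sum _ (hB n)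
  induction k with
  | zero =>
    intro ℓ p hp
    simp only [pow_zero, one_mul]
    have hsq : ∀ ℓ : ℕ, Tendsto (fun n : ℕ => ∫ ω, A (fun i => Xb n i ω) n ℓ (fun _ => 2) ∂Pr)
        atTop (nhds (c ^ ℓ)) := by
      intro ℓ
      cases ℓ with
      | zero =>
        have : ∀ n : ℕ, ∫ ω, A (fun i => Xb n i ω) n 0 (fun _ => 2) ∂Pr = 1 := by
          intro n
          simp [A, Function.injective_of_subsingleton]
        simp [this]
      | succ ℓ =>
        refine (hsquares ℓ).congr fun n => ?_
        rw [integral_A Pr (hB n)]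
    by_cases h1 : ∃ j, p j = 1
    · have hL : Lim c 0 ℓ p = 0 := by
        unfold Lim
        split_ifs with h
        · rfl
        · have : (Finset.univ.filter (fun j => p j = 1)).card ≠ 0 := by
            obtain ⟨j, hj⟩ := h1
            exact Finset.card_ne_zero_of_mem (a := j) (by simp [hj])
          rw [mix, if_neg this, mul_zero]
      rw [hL]
      cases ℓ with
      | zero => exact h1.choose.elim0
      | succ ℓ =>
        refine (hsingleton ℓ p hp h1).congr fun n => ?_
        rw [integral_A Pr (hB n)]
    · push Not at h1
      have hp2 : ∀ j, 2 ≤ p j := fun j => by have := hp j; have := h1 j; omega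
      by_cases h3 : ∃ j, 3 ≤ p j
      · have hL : Lim c 0 ℓ p = 0 := if_pos h3
        rw [hL]
        have h0 : Tendsto (fun n : ℕ => eps n *
            ∫ ω, A (fun i => Xb n i ω) n ℓ (fun _ => 2) ∂Pr) atTop (nhds 0) := by
          simpa using heps_lim.mul (hsq ℓ)
        refine squeeze_zero_norm' ?_ h0
        filter_upwards [heps_lim.eventually (ge_mem_nhds (zero_lt_one))] with n hn
        rw [← integral_const_mul]
        refine norm_integral_le_of_norm_le
          (((Bd.A (hB n) ℓ _).integrable Pr).const_mul _) (ae_of_all _ fun ω => ?_)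
        exact A_bound _ n ℓ p (eps n) hn (fun i hi => hbdd n i hi ω) hp2 h3
      · push Not at h3
        have hp' : p = fun _ => 2 := by
          funext j
          have := hp2 j; have := h3 j; omega
        subst hp'
        have hL : Lim c 0 ℓ (fun _ => 2) = c ^ ℓ := by
          simp [Lim, mix]
        rw [hL]
        exact hsq ℓ
  | succ k ih =>
    intro ℓ p hp
    rw [Lim_succ c k ℓ p hp]
    have hlim := (ih (ℓ+1) (Fin.cons 1 p : Fin (ℓ+1) → ℕ)
      (fun j => Fin.cases (by simp) (fun j => by simpa using hp j) j)).add
      (tendsto_finsetSum Finset.univ fun (j : Fin ℓ) _ =>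
        ih ℓ (fun i => p i + if i = j then 1 else 0) (fun i => le_trans (hp i) (Nat.le_add_right _ _)))
    refine hlim.congr fun n => ?_
    rw [← integral_finsetSum, ← integral_add]
    · refine integral_congr_ae (ae_of_all _ fun ω => ?_)
      simp only []
      rw [pow_succ, mul_assoc, A_mul, mul_add, Finset.mul_sum]
    · exact (((hS n).pow k).mul (Bd.A (hB n) _ _)).integrable Pr
    · exact (Bd.sum _ fun j _ => ((hS n).pow k).mul (Bd.A (hB n) _ _)).integrable Pr
    · intro j _
      exact (((hS n).pow k).mul (Bd.A (hB n) _ _)).integrable Pr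

lemma moments_S (Pr : Measure Ω) [IsProbabilityMeasure Pr]
    (Xb : ℕ → ℕ → Ω → ℝ) (hmeas : ∀ n i, Measurable (Xb n i))
    (eps : ℕ → ℝ) (heps_lim : Tendsto eps atTop (nhds 0))
    (hbdd : ∀ n i, i ∈ Finset.Icc 1 n → ∀ ω, |Xb n i ω| ≤ eps n)
    (c : ℝ)
    (hsingleton : ∀ (ℓ : ℕ) (pvec : Fin (ℓ + 1) → ℕ),
      (∀ j, 1 ≤ pvec j) → (∃ j, pvec j = 1) →
      Tendsto (fun n : ℕ =>
          ∑ i ∈ (Fintype.piFinset fun _ : Fin (ℓ + 1) => Finset.Icc 1 n).filter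
              (fun i => Function.Injective i),
            ∫ ω, ∏ j, Xb n (i j) ω ^ pvec j ∂Pr)
        atTop (nhds 0))
    (hsquares : ∀ ℓ : ℕ,
      Tendsto (fun n : ℕ =>
          ∑ i ∈ (Fintype.piFinset fun _ : Fin (ℓ + 1) => Finset.Icc 1 n).filter
              (fun i => Function.Injective i),
            ∫ ω, ∏ j, Xb n (i j) ω ^ 2 ∂Pr)
        atTop (nhds (c ^ (ℓ + 1)))) (k : ℕ) :
      Tendsto (fun n : ℕ => ∫ ω, (∑ i ∈ Finset.Icc 1 n, Xb n i ω) ^ k ∂Pr)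
        atTop (nhds (mom c k)) := by
  have := moments Pr Xb hmeas eps heps_lim hbdd c hsingleton hsquares k 0 Fin.elim0
    (fun j => j.elim0)
  have hL : Lim c k 0 Fin.elim0 = mom c k := by simp [Lim, mix_zero]
  rw [hL] at this
  refine this.congr fun n => ?_
  simp [A, Function.injective_of_subsingleton]

/-- Convergence of moments to the Gaussian ones implies convergence of characteristic functions. -/
lemma charFun_lim (Pr : Measure Ω) [IsProbabilityMeasure Pr] (S : ℕ → Ω → ℝ)
    (hS : ∀ n, Bd (S n)) (c : ℝ)
    (hm : ∀ k, Tendsto (fun n => ∫ ω, S n ω ^ k ∂Pr) atTop (nhds (mom c k))) (t : ℝ) :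
    Tendsto (fun n => ∫ ω, Complex.exp (t * S n ω * Complex.I) ∂Pr) atTop
      (nhds (Complex.exp (-(c * t^2/2 : ℝ)))) := by
  rw [Metric.tendsto_atTop]
  intro δ hδ
  have h1 : Tendsto (fun M => ∑ j ∈ Finset.range M,
      (-(c * t^2/2 : ℝ) : ℂ) ^ j / (j.factorial : ℂ)) atTop
      (nhds (Complex.exp (-(c * t^2/2 : ℝ)))) := by
    rw [Complex.exp_eq_exp_ℂ]
    exact (NormedSpace.expSeries_div_hasSum_exp (-(c * t^2/2 : ℝ) : ℂ)).tendsto_sum_nat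
  have h2 : Tendsto (fun M : ℕ => (c * t^2/2) ^ M / (M.factorial : ℝ)) atTop (nhds 0) :=
    FloorSemiring.tendsto_pow_div_factorial_atTop _
  obtain ⟨M, hM1, hM2⟩ := ((h1.eventually (Metric.ball_mem_nhds _ (by positivity : 0 < δ/3))).and
    (h2.eventually (gt_mem_nhds (by positivity : 0 < δ/3)))).exists
  -- the truncated expansion
  have h3 : Tendsto (fun n => ∑ k ∈ Finset.range (2*M), (t * Complex.I) ^ k / (k.factorial : ℂ) *
      ((∫ ω, S n ω ^ k ∂Pr : ℝ) : ℂ)) atTop (nhds (∑ j ∈ Finset.range M,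
      (-(c * t^2/2 : ℝ) : ℂ) ^ j / (j.factorial : ℂ))) := by
    rw [← partial_sum]
    refine tendsto_finsetSum _ fun k _ => Tendsto.const_mul _ ?_
    exact (Complex.continuous_ofReal.tendsto _).comp (hm k)
  have h4 : Tendsto (fun n => t ^ (2*M) / ((2*M).factorial : ℝ) * ∫ ω, S n ω ^ (2*M) ∂Pr) atTop
      (nhds ((c * t^2/2) ^ M / (M.factorial : ℝ))) := by
    have : (c * t^2/2) ^ M / (M.factorial : ℝ) = t ^ (2*M) / ((2*M).factorial : ℝ) * mom c (2*M) := by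
      rw [div_mul_eq_mul_div, mul_div_assoc (t ^ (2*M)), mom_even, pow_mul, ← mul_div_assoc,
        ← mul_pow]
      congr 2; ring
    rw [this]
    exact (hm (2*M)).const_mul _
  have h5 := h3.eventually (Metric.ball_mem_nhds _ (by positivity : 0 < δ/3))
  have h6 := h4.eventually (gt_mem_nhds hM2)
  obtain ⟨N, hN⟩ := eventually_atTop.1 (h5.and h6)
  refine ⟨N, fun n hn => ?_⟩
  obtain ⟨h7, h8⟩ := hN n hn
  have hIntg : ∀ k, Integrable (fun ω => ((S n ω ^ k : ℝ) : ℂ)) Pr :=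
    fun k => (((hS n).pow k).integrable Pr).ofReal
  have h9 : ∑ k ∈ Finset.range (2*M), (t * Complex.I) ^ k / (k.factorial : ℂ) *
      ((∫ ω, S n ω ^ k ∂Pr : ℝ) : ℂ) = ∫ ω, ∑ k ∈ Finset.range (2*M),
        ((t * S n ω : ℝ) * Complex.I) ^ k / (k.factorial : ℂ) ∂Pr := by
    have e : ∀ ω, ∀ k, ((t * S n ω : ℝ) * Complex.I) ^ k / (k.factorial : ℂ) =
        (t * Complex.I) ^ k / (k.factorial : ℂ) * ((S n ω ^ k : ℝ) : ℂ) := by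
      intro ω k; push_cast; ring
    simp_rw [e]
    rw [integral_finsetSum _ fun k _ => (hIntg k).const_mul _]
    refine Finset.sum_congr rfl fun k _ => ?_
    rw [integral_const_mul, integral_complex_ofReal]
  have hintS : Integrable (fun ω => ∑ k ∈ Finset.range (2*M),
        ((t * S n ω : ℝ) * Complex.I) ^ k / (k.factorial : ℂ)) Pr := by
    have e : ∀ ω, ∀ k, ((t * S n ω : ℝ) * Complex.I) ^ k / (k.factorial : ℂ) =
        (t * Complex.I) ^ k / (k.factorial : ℂ) * ((S n ω ^ k : ℝ) : ℂ) := by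
      intro ω k; push_cast; ring
    simp_rw [e]
    exact integrable_finsetSum _ fun k _ => (hIntg k).const_mul _
  have hintE : Integrable (fun ω => Complex.exp (t * S n ω * Complex.I)) Pr := by
    have hmS := (hS n).1
    refine Integrable.of_bound (by fun_prop) 1 (ae_of_all _ fun ω => ?_)
    rw [← Complex.ofReal_mul, Complex.norm_exp_ofReal_mul_I]
  have h10 : dist (∫ ω, Complex.exp (t * S n ω * Complex.I) ∂Pr)
      (∑ k ∈ Finset.range (2*M), (t * Complex.I) ^ k / (k.factorial : ℂ) *
      ((∫ ω, S n ω ^ k ∂Pr : ℝ) : ℂ)) ≤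
      t ^ (2*M) / ((2*M).factorial : ℝ) * ∫ ω, S n ω ^ (2*M) ∂Pr := by
    rw [h9, dist_eq_norm, ← integral_sub hintE hintS, ← integral_const_mul]
    refine norm_integral_le_of_norm_le ((((hS n).pow (2*M)).integrable Pr).const_mul _)
      (ae_of_all _ fun ω => ?_)
    have := taylor_bound (2*M) (t * S n ω)
    rw [Even.pow_abs ⟨M, by ring⟩] at this
    rw [← Complex.ofReal_mul]
    refine this.trans (le_of_eq ?_)
    ring
  have h11 := dist_triangle4 (∫ ω, Complex.exp (t * S n ω * Complex.I) ∂Pr)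
    (∑ k ∈ Finset.range (2*M), (t * Complex.I) ^ k / (k.factorial : ℂ) *
      ((∫ ω, S n ω ^ k ∂Pr : ℝ) : ℂ)) (∑ j ∈ Finset.range M,
      (-(c * t^2/2 : ℝ) : ℂ) ^ j / (j.factorial : ℂ)) (Complex.exp (-(c * t^2/2 : ℝ)))
  linarith

end

end CltMoments

/-- **CLT for bounded triangular arrays via moments.**
Let `{X̄_{n,i} : 1 ≤ i ≤ n}` be a triangular array of centered random variables,
uniformly bounded by a sequence `ε_n ↓ 0`.  If all joint moments over pairwise
distinct indices containing a singleton vanish asymptotically, and the sums of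
products of squares over pairwise distinct indices converge to `c^ℓ`, then
`S̄_n = ∑_{i=1}^n X̄_{n,i}` converges in distribution to `N(0,c)`. -/
theorem clt_bounded_array_moments
    {Ω : Type} [MeasurableSpace Ω] (Pr : Measure Ω) (hPr : IsProbabilityMeasure Pr)
    (Xb : ℕ → ℕ → Ω → ℝ) (hmeas : ∀ n i, Measurable (Xb n i))
    (eps : ℕ → ℝ) (heps_anti : Antitone eps) (heps_lim : Tendsto eps atTop (nhds 0))
    (hbdd : ∀ n i, i ∈ Finset.Icc 1 n → ∀ ω, |Xb n i ω| ≤ eps n)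
    (hcent : ∀ n i, i ∈ Finset.Icc 1 n → (∫ ω, Xb n i ω ∂Pr) = 0)
    (c : ℝ) (hc : 0 ≤ c)
    (hsingleton : ∀ (ℓ : ℕ) (pvec : Fin (ℓ + 1) → ℕ),
      (∀ j, 1 ≤ pvec j) → (∃ j, pvec j = 1) →
      Tendsto (fun n : ℕ =>
          ∑ i ∈ (Fintype.piFinset fun _ : Fin (ℓ + 1) => Finset.Icc 1 n).filter
              (fun i => Function.Injective i),
            ∫ ω, ∏ j, Xb n (i j) ω ^ pvec j ∂Pr)
        atTop (nhds 0))
    (hsquares : ∀ ℓ : ℕ,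
      Tendsto (fun n : ℕ =>
          ∑ i ∈ (Fintype.piFinset fun _ : Fin (ℓ + 1) => Finset.Icc 1 n).filter
              (fun i => Function.Injective i),
            ∫ ω, ∏ j, Xb n (i j) ω ^ 2 ∂Pr)
        atTop (nhds (c ^ (ℓ + 1)))) :
    ∀ F : BoundedContinuousFunction ℝ ℝ,
      Tendsto (fun n : ℕ => ∫ ω, F (∑ i ∈ Finset.Icc 1 n, Xb n i ω) ∂Pr)
        atTop
        (nhds (∫ x, F x ∂(ProbabilityTheory.gaussianReal 0 (Real.toNNReal c)))) := by
  intro F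
  haveI := hPr
  have hB : ∀ n, CltMoments.Bd (fun ω => ∑ i ∈ Finset.Icc 1 n, Xb n i ω) :=
    fun n => CltMoments.Bd.sum _ fun i hi => ⟨hmeas n i, eps n, hbdd n i hi⟩
  have hchar := CltMoments.charFun_lim Pr (fun n ω => ∑ i ∈ Finset.Icc 1 n, Xb n i ω) hB c
    (CltMoments.moments_S Pr Xb hmeas eps heps_lim hbdd c hsingleton hsquares)
  let μ : ℕ → ProbabilityMeasure ℝ := fun n =>
    ⟨Pr.map (fun ω => ∑ i ∈ Finset.Icc 1 n, Xb n i ω),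
      Measure.isProbabilityMeasure_map (hB n).1.aemeasurable⟩
  let μ₀ : ProbabilityMeasure ℝ := ⟨ProbabilityTheory.gaussianReal 0 (Real.toNNReal c),
    inferInstance⟩
  have hμ : Tendsto μ atTop (nhds μ₀) := by
    refine ProbabilityMeasure.tendsto_of_tendsto_charFun fun t => ?_
    have e0 : charFun (μ₀ : Measure ℝ) t = Complex.exp (-(c * t^2/2 : ℝ)) := by
      change charFun (ProbabilityTheory.gaussianReal 0 (Real.toNNReal c)) t = _
      rw [ProbabilityTheory.charFun_gaussianReal]
      congr 1
      have : ((Real.toNNReal c : ℝ≥0) : ℂ) = (c : ℂ) := by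
        exact_mod_cast congrArg (fun x : ℝ => (x : ℂ)) (Real.coe_toNNReal c hc)
      rw [this]
      push_cast
      ring
    rw [e0]
    refine (hchar t).congr fun n => ?_
    change _ = charFun (Pr.map (fun ω => ∑ i ∈ Finset.Icc 1 n, Xb n i ω)) t
    rw [charFun_apply_real, integral_map (hB n).1.aemeasurable (by fun_prop)]
  have := (ProbabilityMeasure.tendsto_iff_forall_integral_tendsto.1 hμ) F
  refine this.congr fun n => ?_
  change ∫ x, F x ∂(Pr.map (fun ω => ∑ i ∈ Finset.Icc 1 n, Xb n i ω)) = _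
  rw [integral_map (hB n).1.aemeasurable F.continuous.aestronglyMeasurable]

end
end
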